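/- Given a graph G, an H-model f of G, a label a, and a leaf block L of the block tree of G(f,a), suppose G(f,a) has at least one vertex outside L, L contains at least one interior vertex that is the endpoint of a connecting edge, and f does not hit a leaf-crucial model on relabeling L. Then f can be reconfigured (by single-vertex relabeling steps, each yielding an H-model) to an H-model g such that g(v) ≠ f(v) for every interior vertex v of G(f,a) lying in L, and g(u) = f(u) for all other vertices u. -/

import Mathlib

open SimpleGraph

section Defs

variable {V : Type*} {W : Type*}

/-- `f` is an `H`-model of `G`: every branch set (preimage of a label) is nonempty and
connected, and for every edge of `H` there is a connecting edge of `G`. -/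
def IsModel (G : SimpleGraph V) (H : SimpleGraph W) (f : V → W) : Prop :=
  (∀ i : W, (f ⁻¹' {i}).Nonempty ∧ (G.induce (f ⁻¹' {i})).Connected) ∧
  ∀ ⦃i j : W⦄, H.Adj i j → ∃ u v : V, G.Adj u v ∧ f u = i ∧ f v = j

/-- One reconfiguration step: both endpoints are `H`-models and they differ on exactly
one vertex of `G`. -/
def ModelStep (G : SimpleGraph V) (H : SimpleGraph W) (f g : V → W) : Prop :=
  IsModel G H f ∧ IsModel G H g ∧ ∃ v : V, f v ≠ g v ∧ ∀ u : V, u ≠ v → f u = g u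

/-- `G` is in `host(H)`: it admits an `H`-model and the reconfiguration graph of
`H`-models of `G` is connected. -/
def InHost (G : SimpleGraph V) (H : SimpleGraph W) : Prop :=
  (∃ f : V → W, IsModel G H f) ∧
  ∀ f g : V → W, IsModel G H f → IsModel G H g →
    Relation.ReflTransGen (ModelStep G H) f g

/-- `S` is a cut set of `G`: deleting `S` leaves at least two components. -/
def IsCutSet (G : SimpleGraph V) (S : Set V) : Prop :=
  ∃ u w : ↥(Sᶜ), ¬ (G.induce Sᶜ).Reachable u w

/-- `G` is `k`-connected: it has no cut set of fewer than `k` vertices. -/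
def KConnected (G : SimpleGraph V) (k : ℕ) : Prop :=
  ∀ S : Set V, S.Finite → S.ncard < k → ¬ IsCutSet G S

/-- `v` is a cut vertex of the subgraph of `G` induced on `A`. -/
def IsCutVertexOf (G : SimpleGraph V) (A : Set V) (v : V) : Prop :=
  v ∈ A ∧ ∃ u w : ↥(A \ {v}), ¬ (G.induce (A \ {v})).Reachable u w

def NoCutVertexIn (G : SimpleGraph V) (B : Set V) : Prop :=
  ∀ v : V, ¬ IsCutVertexOf G B v

/-- `B` is a block of the subgraph of `G` induced on `A`: a maximal connected subgraph
of it without a cut vertex. -/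
def IsBlockOf (G : SimpleGraph V) (A B : Set V) : Prop :=
  B ⊆ A ∧ B.Nonempty ∧ (G.induce B).Connected ∧ NoCutVertexIn G B ∧
  ∀ B' : Set V, B ⊆ B' → B' ⊆ A → (G.induce B').Connected → NoCutVertexIn G B' → B' = B

/-- `B` is a leaf block of the subgraph of `G` induced on `A`: a block containing at
most one joining vertex (cut vertex of the induced subgraph on `A`). -/
def IsLeafBlockOf (G : SimpleGraph V) (A B : Set V) : Prop :=
  IsBlockOf G A B ∧
  ∀ v w : V, v ∈ B → w ∈ B → IsCutVertexOf G A v → IsCutVertexOf G A w → v = w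

/-- `v` is essential for label `b`: `f v` and `b` are adjacent labels of `H` and every
connecting edge between the branch sets of `f v` and of `b` has `v` as an endpoint. -/
def EssentialFor (G : SimpleGraph V) (H : SimpleGraph W) (f : V → W) (v : V) (b : W) : Prop :=
  H.Adj (f v) b ∧ ∀ u w : V, G.Adj u w → f u = f v → f w = b → u = v

/-- `v` is crucial: essential for two distinct labels. -/
def IsCrucial (G : SimpleGraph V) (H : SimpleGraph W) (f : V → W) (v : V) : Prop :=
  ∃ b c : W, b ≠ c ∧ EssentialFor G H f v b ∧ EssentialFor G H f v c

/-- `v` is `b`-crucial: `v` has a neighbour labeled `b` and is essential for some label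
`c ∉ {f v, b}`. -/
def IsBCrucial (G : SimpleGraph V) (H : SimpleGraph W) (f : V → W) (v : V) (b : W) : Prop :=
  (∃ u : V, G.Adj v u ∧ f u = b) ∧
  ∃ c : W, c ≠ f v ∧ c ≠ b ∧ EssentialFor G H f v c

/-- `uv` is the unique (essential) connecting edge between branch sets `a` and `b`. -/
def IsEssEdge (G : SimpleGraph V) (f : V → W) (a b : W) (u v : V) : Prop :=
  G.Adj u v ∧ f u = a ∧ f v = b ∧
  ∀ u' v' : V, G.Adj u' v' → f u' = a → f v' = b → u' = u ∧ v' = v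

/-- The branch sets of labels `a` and `b` are weakly connected. -/
def WeaklyConnected (G : SimpleGraph V) (H : SimpleGraph W) (f : V → W) (a b : W) : Prop :=
  (∃ v : V, f v = a ∧ EssentialFor G H f v b) ∨
  (∃ v : V, f v = b ∧ EssentialFor G H f v a)

/-- `p` is a valid designation of a lynchpin for the weak connection between the branch
sets of `a` and `b`: an endpoint of the essential edge if one exists, and otherwise the
essential vertex giving rise to the weak connection. -/
def IsLynchpin (G : SimpleGraph V) (H : SimpleGraph W) (f : V → W) (a b : W) (p : V) : Prop :=
  (∃ u v : V, IsEssEdge G f a b u v ∧ (p = u ∨ p = v)) ∨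
  ((∀ u v : V, ¬ IsEssEdge G f a b u v) ∧
    ((f p = a ∧ EssentialFor G H f p b) ∨ (f p = b ∧ EssentialFor G H f p a)))

/-- `C` is a connected component of the subgraph of `G` induced on `A`. -/
def IsCompOf (G : SimpleGraph V) (A C : Set V) : Prop :=
  C ⊆ A ∧ C.Nonempty ∧ (G.induce C).Connected ∧
  ∀ C' : Set V, C ⊆ C' → C' ⊆ A → (G.induce C').Connected → C' = C

/-- One reconfiguration step that changes (the label of) a vertex of `A` only. -/
def ModelStepWithin (G : SimpleGraph V) (H : SimpleGraph W) (A : Set V) (f g : V → W) : Prop :=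
  IsModel G H f ∧ IsModel G H g ∧ ∃ v ∈ A, f v ≠ g v ∧ ∀ u : V, u ≠ v → f u = g u

/-- `g` is reachable from `f` by reconfiguration steps changing only vertices of `A`. -/
def ReachWithin (G : SimpleGraph V) (H : SimpleGraph W) (A : Set V) (f g : V → W) : Prop :=
  Relation.ReflTransGen (ModelStepWithin G H A) f g

/-- `f` is a leaf-crucial model: some crucial vertex is an interior vertex in a leaf
block of its branch set. -/
def LeafCrucialModel (G : SimpleGraph V) (H : SimpleGraph W) (f : V → W) : Prop :=
  ∃ (v : V) (L : Set V), IsLeafBlockOf G (f ⁻¹' {f v}) L ∧ v ∈ L ∧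
    ¬ IsCutVertexOf G (f ⁻¹' {f v}) v ∧ IsCrucial G H f v

/-- `f` is a leaf-`b`-crucial model: some `b`-crucial vertex is an interior vertex in a
leaf block of its branch set. -/
def LeafBCrucialModel (G : SimpleGraph V) (H : SimpleGraph W) (f : V → W) (b : W) : Prop :=
  ∃ (v : V) (L : Set V), IsLeafBlockOf G (f ⁻¹' {f v}) L ∧ v ∈ L ∧
    ¬ IsCutVertexOf G (f ⁻¹' {f v}) v ∧ IsBCrucial G H f v b

/-- `f` hits a leaf-crucial model on relabeling `A`. -/
def HitsLeafCrucial (G : SimpleGraph V) (H : SimpleGraph W) (A : Set V) (f : V → W) : Prop :=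
  ∀ g : V → W, ReachWithin G H A f g →
    ∃ h : V → W, ReachWithin G H A g h ∧ LeafCrucialModel G H h

/-- `f` hits a leaf-`b`-crucial model on relabeling `A`. -/
def HitsLeafBCrucial (G : SimpleGraph V) (H : SimpleGraph W) (A : Set V) (f : V → W)
    (b : W) : Prop :=
  ∀ g : V → W, ReachWithin G H A f g →
    ∃ h : V → W, ReachWithin G H A g h ∧ LeafBCrucialModel G H h b

end Defs

/-- `T` is a union of components of the subgraph of `G` induced on `S`. -/
def IsClosedIn {V : Type*} (G : SimpleGraph V) (S T : Set V) : Prop :=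
  T ⊆ S ∧ ∀ u ∈ T, ∀ w ∈ S, G.Adj u w → w ∈ T

/-- The only nonempty union of components of the subgraph of `G` induced on `S` is `S`. -/
def SetConn {V : Type*} (G : SimpleGraph V) (S : Set V) : Prop :=
  ∀ T : Set V, IsClosedIn G S T → T.Nonempty → T = S

section SetConn

variable {V : Type*} {W : Type*} {G : SimpleGraph V} {H : SimpleGraph W}

lemma IsClosedIn.compl {S T : Set V} (h : IsClosedIn G S T) : IsClosedIn G S (S \ T) :=
  ⟨Set.sdiff_subset, fun u hu w hw huw => ⟨hw, fun hwT => hu.2 (h.2 w hwT u hu.1 huw.symm)⟩⟩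

lemma IsClosedIn.inter {S T S' : Set V} (h : IsClosedIn G S T) (hS : S' ⊆ S) :
    IsClosedIn G S' (T ∩ S') :=
  ⟨Set.inter_subset_right, fun u hu w hw huw => ⟨h.2 u hu.1 w (hS hw) huw, hw⟩⟩

lemma preconnected_induce_iff_setConn {S : Set V} : (G.induce S).Preconnected ↔ SetConn G S := by
  constructor
  · rintro h T ⟨hTS, hT⟩ ⟨t, ht⟩
    refine hTS.antisymm fun w hw => ?_
    obtain ⟨p⟩ := h ⟨t, hTS ht⟩ ⟨w, hw⟩
    have key : ∀ {x y : S}, (G.induce S).Walk x y → (x : V) ∈ T → (y : V) ∈ T := by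
      intro x y q
      induction q with
      | nil => exact id
      | cons hadj _ ih => exact fun hx => ih (hT _ hx _ (Subtype.coe_prop _) hadj)
    exact key p ht
  · intro h u w
    let T : Set V := Subtype.val '' {z : S | (G.induce S).Reachable u z}
    have hT : T = S := by
      refine h T ⟨?_, ?_⟩ ⟨u, u, SimpleGraph.Reachable.refl u, rfl⟩
      · rintro _ ⟨z, -, rfl⟩
        exact z.2
      · rintro _ ⟨z, hz, rfl⟩ y hy hadj
        have hzy : (G.induce S).Adj z ⟨y, hy⟩ := hadj
        exact ⟨⟨y, hy⟩, SimpleGraph.Reachable.trans hz hzy.reachable, rfl⟩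
    have hw : (w : V) ∈ T := hT.symm ▸ w.2
    obtain ⟨z, hz, hzw⟩ := hw
    rwa [← Subtype.ext hzw]

lemma connected_induce_iff_setConn {S : Set V} :
    (G.induce S).Connected ↔ S.Nonempty ∧ SetConn G S := by
  rw [connected_iff, preconnected_induce_iff_setConn, Set.nonempty_coe_sort, and_comm]

lemma isCutVertexOf_iff {A : Set V} {v : V} :
    IsCutVertexOf G A v ↔ v ∈ A ∧ ¬ SetConn G (A \ {v}) := by
  rw [← preconnected_induce_iff_setConn]
  simp only [IsCutVertexOf, SimpleGraph.Preconnected, not_forall]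

lemma noCutVertexIn_iff {B : Set V} :
    NoCutVertexIn G B ↔ ∀ v ∈ B, SetConn G (B \ {v}) := by
  simp only [NoCutVertexIn, isCutVertexOf_iff, not_and, not_not]

lemma NoCutVertexIn.setConn_diff {B : Set V} (h : NoCutVertexIn G B) (hB : SetConn G B) (x : V) :
    SetConn G (B \ {x}) := by
  by_cases hx : x ∈ B
  · exact noCutVertexIn_iff.1 h x hx
  · rwa [Set.sdiff_singleton_eq_self hx]

lemma SetConn.insert_of_adj {S : Set V} (h : SetConn G S) {u w : V} (hw : w ∈ S)
    (huw : G.Adj u w) : SetConn G (insert u S) := by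
  rintro T hT ⟨t, ht⟩
  have key : S ⊆ T := by
    have hne : (T ∩ S).Nonempty := by
      rcases hT.1 ht with rfl | htS
      · exact ⟨w, hT.2 t ht w (Or.inr hw) huw, hw⟩
      · exact ⟨t, ht, htS⟩
    exact Set.inter_eq_right.1 (h _ (hT.inter (Set.subset_insert u S)) hne)
  exact hT.1.antisymm
    (Set.insert_subset (hT.2 w (key hw) u (Set.mem_insert u S) huw.symm) key)

/-- Components left after deleting `x` from a connected set stay connected together with `x`. -/
lemma SetConn.insert_of_isClosedIn {S C : Set V} {x : V} (hS : SetConn G S) (hx : x ∈ S)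
    (hC : IsClosedIn G (S \ {x}) C) : SetConn G (insert x C) := by
  have hCS : insert x C ⊆ S := Set.insert_subset hx fun v hv => (hC.1 hv).1
  have key : ∀ T, IsClosedIn G (insert x C) T → T.Nonempty → x ∈ T := by
    intro T hT hne
    by_contra hxT
    have hTS : T = S := by
      refine hS T ⟨hT.1.trans hCS, fun u hu w hw huw => hT.2 u hu w ?_ huw⟩ hne
      by_cases hwx : w = x
      · exact Or.inl hwx
      · have huC : u ∈ C := (hT.1 hu).resolve_left fun h => hxT (h ▸ hu)
        exact Or.inr (hC.2 u huC w ⟨hw, hwx⟩ huw)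
    exact hxT (hTS ▸ hx)
  intro T hT hne
  by_contra hTC
  refine (key _ hT.compl ?_).2 (key T hT hne)
  by_contra hemp
  exact hTC (hT.1.antisymm (Set.sdiff_eq_empty.1 (Set.not_nonempty_iff_eq_empty.1 hemp)))

/-- A set that is not connected has a nonempty union of components avoiding a given vertex. -/
lemma exists_isClosedIn_of_not_setConn {S : Set V} (h : ¬ SetConn G S) (x : V) :
    ∃ T, IsClosedIn G S T ∧ T.Nonempty ∧ x ∉ T := by
  simp only [SetConn, not_forall] at h
  obtain ⟨T, hT, hne, hTS⟩ := h
  by_cases hx : x ∈ T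
  · refine ⟨S \ T, hT.compl, ?_, fun h => h.2 hx⟩
    by_contra hemp
    exact hTS (hT.1.antisymm (Set.sdiff_eq_empty.1 (Set.not_nonempty_iff_eq_empty.1 hemp)))
  · exact ⟨T, hT, hne, hx⟩

/-- A vertex of a block with a neighbour outside the block is a cut vertex. -/
lemma IsBlockOf.isCutVertexOf_of_adj [Finite V] {A L : Set V} (hL : IsBlockOf G A L)
    {u w : V} (hu : u ∈ L) (hwA : w ∈ A) (hwL : w ∉ L) (huw : G.Adj u w) :
    IsCutVertexOf G A u := by
  obtain ⟨hLA, -, hLc, hLn, hmax⟩ := hL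
  have hLconn : SetConn G L := (connected_induce_iff_setConn.1 hLc).2
  by_contra hcut
  have hAu : SetConn G (A \ {u}) := by
    by_contra h
    exact hcut (isCutVertexOf_iff.2 ⟨hLA hu, h⟩)
  obtain ⟨P, ⟨hPA, hwP, hPc⟩, hPmin⟩ := exists_minimal_of_wellFoundedLT
    (fun P : Set V => P ⊆ A \ L ∧ w ∈ P ∧ SetConn G (P ∪ L \ {u})) ⟨A \ L, subset_rfl, ⟨hwA, hwL⟩, by
      convert hAu using 1
      ext z
      by_cases hz : z ∈ L
      · simp [hz, hLA hz]
      · have : z ≠ u := fun h => hz (h ▸ hu)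
        simp [hz, this]⟩
  have hins : P ∪ L = insert u (P ∪ L \ {u}) := by
    ext z
    by_cases hz : z = u
    · simp [hz, hu]
    · simp [hz]
  have huP : u ∉ P := fun h => (hPA h).2 hu
  have hconn : SetConn G (P ∪ L) := hins ▸ hPc.insert_of_adj (Or.inl hwP) huw
  have hnc : NoCutVertexIn G (P ∪ L) := by
    rw [noCutVertexIn_iff]
    intro y hy
    by_cases hyu : y = u
    · subst hyu
      rwa [Set.union_sdiff_distrib, Set.sdiff_singleton_eq_self huP]
    by_contra hdis
    obtain ⟨T, hT, ⟨t, ht⟩, huT⟩ := exists_isClosedIn_of_not_setConn hdis u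
    have hTL : ∀ z ∈ T, z ∉ L := by
      intro z hz hzL
      have hLy := hLn.setConn_diff hLconn y _
        (hT.inter (Set.sdiff_subset_sdiff_left Set.subset_union_right))
        ⟨z, hz, hzL, (hT.1 hz).2⟩
      have hu' : u ∈ T ∩ (L \ {y}) := by
        rw [hLy]
        exact ⟨hu, fun h => hyu h.symm⟩
      exact huT hu'.1
    have hwT : w ∉ T := fun h =>
      huT (hT.2 w h u ⟨Or.inr hu, fun h => hyu h.symm⟩ huw.symm)
    set S := P ∪ L \ {u} with hS
    have hyS : y ∈ S := hy.imp id fun h => ⟨h, hyu⟩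
    have hTP : ∀ z ∈ T, z ∈ P := fun z hz => (hT.1 hz).1.resolve_right (hTL z hz)
    have hTS : IsClosedIn G (S \ {y}) T := by
      refine ⟨fun z hz => ⟨Or.inl (hTP z hz), (hT.1 hz).2⟩, fun a ha b hb hab => hT.2 a ha b ?_ hab⟩
      exact ⟨hb.1.imp id fun h => h.1, hb.2⟩
    have hrest := hPc.insert_of_isClosedIn hyS hTS.compl
    have heq : insert y ((S \ {y}) \ T) = (P \ T) ∪ L \ {u} := by
      have hyT : y ∉ T := fun h => (hT.1 h).2 rfl
      ext z
      by_cases hzy : z = y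
      · subst hzy
        simpa [hyT, hyu] using hy
      · have := hTL z
        simp only [hS, Set.mem_insert_iff, Set.mem_sdiff, Set.mem_union, Set.mem_singleton_iff]
        tauto
    have hle := hPmin (y := P \ T)
      ⟨fun z hz => hPA hz.1, ⟨hwP, hwT⟩, heq ▸ hrest⟩ Set.sdiff_subset
    exact (hle (hTP t ht)).2 ht
  have := hmax (P ∪ L) Set.subset_union_right
    (Set.union_subset (fun z hz => (hPA hz).1) hLA)
    (connected_induce_iff_setConn.2 ⟨⟨u, Or.inr hu⟩, hconn⟩) hnc
  exact hwL (this ▸ Or.inl hwP)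

/-- A union `P` of components left after deleting one vertex contains all but one vertex of some
leaf block, and these vertices are not cut vertices. -/
lemma exists_isLeafBlockOf_insert [Finite V] {A P : Set V} {c : V} (hA : SetConn G A) (hc : c ∈ A)
    (hP : IsClosedIn G (A \ {c}) P) (hne : P.Nonempty) :
    ∃ x C, C.Nonempty ∧ C ⊆ P ∧ IsClosedIn G (A \ {x}) C ∧ IsLeafBlockOf G A (insert x C) ∧
      ∀ y ∈ C, ¬ IsCutVertexOf G A y := by
  obtain ⟨C, ⟨x, hx, hCne, hCP, hC⟩, hmin⟩ := exists_minimal_of_wellFoundedLT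
    (fun C : Set V => ∃ x ∈ A, C.Nonempty ∧ C ⊆ P ∧ IsClosedIn G (A \ {x}) C)
    ⟨P, c, hc, hne, subset_rfl, hP⟩
  have hmin' : ∀ y ∈ A, ∀ D, D ⊆ C → D.Nonempty → IsClosedIn G (A \ {y}) D → C ⊆ D :=
    fun y hy D hDC hD hcl => hmin (y := D) ⟨y, hy, hD, hDC.trans hCP, hcl⟩ hDC
  have hCA : C ⊆ A := fun v hv => (hC.1 hv).1
  have hxC : x ∉ C := fun h => (hC.1 h).2 rfl
  have hins : insert x C ⊆ A := Set.insert_subset hx hCA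
  have hcut : ∀ y ∈ C, SetConn G (A \ {y}) := by
    intro y hy
    by_contra hdis
    obtain ⟨D, hD, ⟨d, hd⟩, hxD⟩ := exists_isClosedIn_of_not_setConn hdis x
    by_cases hDC : (D ∩ C).Nonempty
    · have hcl : IsClosedIn G (A \ {y}) (D ∩ C) :=
        ⟨fun z hz => hD.1 hz.1, fun a ha b hb hab =>
          have hbD := hD.2 a ha.1 b hb hab
          ⟨hbD, hC.2 a ha.2 b ⟨hb.1, fun h => hxD (h ▸ hbD)⟩ hab⟩⟩
      have hyD := (hmin' y (hCA hy) _ Set.inter_subset_right hDC hcl hy).1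
      exact (hD.1 hyD).2 rfl
    · have hDA : D = A := by
        refine hA D ⟨fun z hz => (hD.1 hz).1, fun a ha b hb hab => ?_⟩ ⟨d, hd⟩
        by_cases hby : b = y
        · subst hby
          exact absurd ⟨a, ha, hC.2 b hy a ⟨(hD.1 ha).1, fun h => hxD (h ▸ ha)⟩ hab.symm⟩ hDC
        · exact hD.2 a ha b ⟨hb, hby⟩ hab
      exact hxD (hDA ▸ hx)
  have hncut : ∀ y ∈ C, ¬ IsCutVertexOf G A y := fun y hy h =>
    (isCutVertexOf_iff.1 h).2 (hcut y hy)
  refine ⟨x, C, hCne, hCP, hC, ⟨⟨hins, Set.insert_nonempty x C, ?_, ?_, ?_⟩, ?_⟩, hncut⟩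
  · exact connected_induce_iff_setConn.2 ⟨Set.insert_nonempty x C, hA.insert_of_isClosedIn hx hC⟩
  · rw [noCutVertexIn_iff]
    rintro z (rfl | hz)
    · rw [Set.insert_sdiff_self_of_notMem hxC]
      intro T hT hTne
      refine hT.1.antisymm (hmin' z hx T hT.1 hTne ⟨hT.1.trans hC.1, fun a ha b hb hab => ?_⟩)
      exact hT.2 a ha b (hC.2 a (hT.1 ha) b hb hab) hab
    · have hxz : x ≠ z := fun h => hxC (h ▸ hz)
      have hcl : IsClosedIn G ((A \ {z}) \ {x}) (C \ {z}) :=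
        ⟨fun a ha => ⟨⟨hCA ha.1, ha.2⟩, (hC.1 ha.1).2⟩, fun a ha b hb hab =>
          ⟨hC.2 a ha.1 b ⟨hb.1.1, hb.2⟩ hab, hb.1.2⟩⟩
      rw [Set.insert_sdiff_of_notMem _ (by simpa using hxz)]
      exact (hcut z hz).insert_of_isClosedIn ⟨hx, hxz⟩ hcl
  · intro B hB hBA hBc hBn
    have hxB : x ∈ B := hB (Set.mem_insert x C)
    have hCB : C = B \ {x} :=
      noCutVertexIn_iff.1 hBn x hxB C
        ⟨fun a ha => ⟨hB (Or.inr ha), (hC.1 ha).2⟩, fun a ha b hb hab =>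
          hC.2 a ha b ⟨hBA hb.1, hb.2⟩ hab⟩ hCne
    rw [hCB, Set.insert_sdiff_singleton, Set.insert_eq_of_mem hxB]
  · intro v w hv hw hvc hwc
    have hv' := hv.resolve_right fun h => hncut v h hvc
    have hw' := hw.resolve_right fun h => hncut w h hwc
    rw [hv', hw']

/-- A vertex that is neither a cut vertex of its branch set nor essential for a label other than
`b` can be relabelled to the label `b` of one of its neighbours. -/
lemma IsModel.update [DecidableEq V] {h : V → W} (hh : IsModel G H h) {v w : V} {b : W}
    (hvw : G.Adj v w) (hw : h w = b) (hb : b ≠ h v)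
    (hcut : ¬ IsCutVertexOf G (h ⁻¹' {h v}) v) (hne : (h ⁻¹' {h v} \ {v}).Nonempty)
    (hess : ∀ j, j ≠ b → ¬ EssentialFor G H h v j) :
    IsModel G H (Function.update h v b) := by
  have hconn : SetConn G (h ⁻¹' {h v}) := (connected_induce_iff_setConn.1 (hh.1 (h v)).2).2
  have hself : Function.update h v b v = b := Function.update_self v b h
  have hother : ∀ z, z ≠ v → Function.update h v b z = h z := fun z hz =>
    Function.update_of_ne hz b h
  have hedge : ∀ j, H.Adj (h v) j →
      ∃ p q, G.Adj p q ∧ Function.update h v b p = h v ∧ Function.update h v b q = j := by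
    intro j hj
    by_cases hjb : j = b
    · subst hjb
      by_contra hno
      have hv : ({v} : Set V) = h ⁻¹' {h v} := by
        refine hconn _ ⟨Set.singleton_subset_iff.2 rfl, ?_⟩ ⟨v, rfl⟩
        rintro _ rfl q hq hvq
        exact absurd ⟨q, _, hvq.symm, (hother q hvq.ne').trans hq, hself⟩ hno
      obtain ⟨z, hz, hzv⟩ := hne
      exact hzv (hv ▸ hz)
    · have := hess j hjb
      simp only [EssentialFor, hj, true_and, not_forall] at this
      obtain ⟨p, q, hpq, hp, hq, hpv⟩ := this
      have hqv : q ≠ v := by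
        rintro rfl
        exact hj.ne hq
      exact ⟨p, q, hpq, (hother p hpv).trans hp, (hother q hqv).trans hq⟩
  refine ⟨fun i => ?_, fun i j hij => ?_⟩
  · suffices hs : (Function.update h v b ⁻¹' {i}).Nonempty ∧
        SetConn G (Function.update h v b ⁻¹' {i}) from ⟨hs.1, connected_induce_iff_setConn.2 hs⟩
    by_cases hib : i = b
    · subst hib
      have heq : Function.update h v i ⁻¹' {i} = insert v (h ⁻¹' {i}) := by
        ext z
        by_cases hz : z = v
        · simp [hz]
        · simp [hz]
      rw [heq]
      exact ⟨Set.insert_nonempty _ _, (connected_induce_iff_setConn.1 (hh.1 i).2).2.insert_of_adj hw hvw⟩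
    have heq : Function.update h v b ⁻¹' {i} = h ⁻¹' {i} \ {v} := by
      ext z
      by_cases hz : z = v
      · simp [hz, Ne.symm hib]
      · simp [hz]
    rw [heq]
    by_cases hi : i = h v
    · subst hi
      refine ⟨hne, ?_⟩
      by_contra hdis
      exact hcut (isCutVertexOf_iff.2 ⟨rfl, hdis⟩)
    · have hv : v ∉ h ⁻¹' {i} := fun hv => hi hv.symm
      rw [Set.sdiff_singleton_eq_self hv]
      exact connected_induce_iff_setConn.1 (hh.1 i).2
  · by_cases hi : i = h v
    · subst hi
      exact hedge j hij
    by_cases hj : j = h v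
    · subst hj
      obtain ⟨p, q, hpq, hp, hq⟩ := hedge i hij.symm
      exact ⟨q, p, hpq.symm, hq, hp⟩
    obtain ⟨p, q, hpq, hp, hq⟩ := hh.2 hij
    have hpv : p ≠ v := fun h' => hi (h' ▸ hp.symm)
    have hqv : q ≠ v := fun h' => hj (h' ▸ hq.symm)
    exact ⟨p, q, hpq, (hother p hpv).trans hp, (hother q hqv).trans hq⟩

lemma ModelStepWithin.symm {A : Set V} {f g : V → W} (h : ModelStepWithin G H A f g) :
    ModelStepWithin G H A g f := by
  obtain ⟨hf, hg, v, hv, hne, heq⟩ := h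
  exact ⟨hg, hf, v, hv, hne.symm, fun u hu => (heq u hu).symm⟩

lemma ReachWithin.symm {A : Set V} {f g : V → W} (h : ReachWithin G H A f g) :
    ReachWithin G H A g f :=
  haveI : Std.Symm (ModelStepWithin G H A) := ⟨fun _ _ => ModelStepWithin.symm⟩
  Relation.ReflTransGen.stdSymm.symm _ _ h

lemma ReachWithin.isModel {A : Set V} {f g : V → W} (h : ReachWithin G H A f g)
    (hf : IsModel G H f) : IsModel G H g := by
  cases h with
  | refl => exact hf
  | tail _ hstep => exact hstep.2.1

lemma ReachWithin.reflTransGen_modelStep {A : Set V} {f g : V → W} (h : ReachWithin G H A f g) :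
    Relation.ReflTransGen (ModelStep G H) f g :=
  h.lift id fun _ _ ⟨hf, hg, v, _, hv⟩ => ⟨hf, hg, v, hv⟩

/-- A vertex that is neither crucial nor a cut vertex of its branch set can be relabelled as soon
as it has a neighbour in another branch set. -/
lemma IsModel.exists_update [DecidableEq V] {h : V → W} (hh : IsModel G H h) {v w : V}
    (hvw : G.Adj v w) (hw : h w ≠ h v) (hcut : ¬ IsCutVertexOf G (h ⁻¹' {h v}) v)
    (hne : (h ⁻¹' {h v} \ {v}).Nonempty) (hcr : ¬ IsCrucial G H h v) :
    ∃ b, b ≠ h v ∧ IsModel G H (Function.update h v b) := by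
  by_cases hess : ∃ b, EssentialFor G H h v b
  · obtain ⟨b, hb⟩ := hess
    obtain ⟨p, q, hpq, hp, hq⟩ := hh.2 hb.1
    obtain rfl := hb.2 p q hpq hp hq
    exact ⟨b, hb.1.ne', hh.update hpq hq hb.1.ne' hcut hne
      fun j hj hess' => hcr ⟨b, j, hj.symm, hb, hess'⟩⟩
  · exact ⟨h w, hw, hh.update hvw rfl hw hcut hne fun j _ hj => hess ⟨j, hj⟩⟩

/-- Relabelling vertices of a leaf block `L` other than its joining vertex `c` leaves a vertex that
can be relabelled next: it is an interior vertex of a leaf block and has a neighbour in another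
branch set. -/
lemma exists_interior_leaf_adj [Finite V] {f h : V → W} {a : W} {L : Set V} {c : V}
    (hL : IsBlockOf G (f ⁻¹' {a}) L) (hc : c ∈ L)
    (hLc : ∀ u ∈ L, u ≠ c → ∀ w, f w = a → G.Adj u w → w ∈ L)
    (hint : ∃ v ∈ L, v ≠ c ∧ ∃ u, G.Adj v u ∧ f u ≠ a)
    (hh : IsModel G H h) (heq : ∀ u, ¬ (u ∈ L ∧ u ≠ c) → h u = f u)
    (hne : ∃ v ∈ L, v ≠ c ∧ h v = a) :
    ∃ v ∈ L, v ≠ c ∧ h v = a ∧ (∃ B, IsLeafBlockOf G (h ⁻¹' {a}) B ∧ v ∈ B) ∧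
      ¬ IsCutVertexOf G (h ⁻¹' {a}) v ∧ ∃ u, G.Adj v u ∧ h u ≠ a := by
  have hLA : ∀ u ∈ L, f u = a := fun u hu => hL.1 hu
  have hLconn : SetConn G L := (connected_induce_iff_setConn.1 hL.2.2.1).2
  have hca : h c = a := (heq c fun h => h.2 rfl).trans (hLA c hc)
  let P : Set V := {v | v ∈ L ∧ v ≠ c ∧ h v = a}
  have hP : IsClosedIn G (h ⁻¹' {a} \ {c}) P := by
    refine ⟨fun v hv => ⟨hv.2.2, hv.2.1⟩, fun u hu w hw huw => ?_⟩
    by_cases hwL : w ∈ L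
    · exact ⟨hwL, hw.2, hw.1⟩
    · exact absurd (hLc u hu.1 hu.2.1 w ((heq w fun h => hwL h.1).symm.trans hw.1) huw) hwL
  obtain ⟨x, C, hCne, hCP, hC, hleaf, hcut⟩ :=
    exists_isLeafBlockOf_insert (connected_induce_iff_setConn.1 (hh.1 a).2).2 hca hP hne
  suffices hadj : ∃ v ∈ C, ∃ u, G.Adj v u ∧ h u ≠ a by
    obtain ⟨v, hv, hu⟩ := hadj
    have hvP := hCP hv
    exact ⟨v, hvP.1, hvP.2.1, hvP.2.2, ⟨_, hleaf, Or.inr hv⟩, hcut v hv, hu⟩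
  by_contra hno
  push Not at hno
  have hCL : C = L \ {x} := by
    refine hL.2.2.2.1.setConn_diff hLconn x C
      ⟨fun v hv => ⟨(hCP hv).1, (hC.1 hv).2⟩, fun u hu w hw huw => ?_⟩ hCne
    exact hC.2 u hu w ⟨hno u hu w huw, hw.2⟩ huw
  have hxc : c = x := by
    by_contra hcx
    have hcC : c ∈ C := hCL ▸ ⟨hc, hcx⟩
    exact (hCP hcC).2.1 rfl
  subst hxc
  have hhf : ∀ u, h u = f u := by
    intro u
    by_cases hu : u ∈ L ∧ u ≠ c
    · have huC : u ∈ C := hCL ▸ hu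
      rw [(hCP huC).2.2, hLA u hu.1]
    · exact heq u hu
  obtain ⟨v, hv, hvc, u, hvu, hu⟩ := hint
  exact hu (hhf u ▸ hno v (hCL ▸ ⟨hv, hvc⟩) u hvu)

end SetConn

/-- if `G(f,a)` has a vertex outside the leaf block `L`, `L` contains an
interior vertex that is an endpoint of a connecting edge, and `f` does not hit a
leaf-crucial model on relabeling `L`, then `f` reconfigures to a model `g` that differs
from `f` exactly on the interior vertices of `G(f,a)` lying in `L`. -/
theorem stmt15 {V W : Type} [Fintype V] (G : SimpleGraph V) (H : SimpleGraph W)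
    (f : V → W) (hf : IsModel G H f) (a : W) (L : Set V)
    (hL : IsLeafBlockOf G (f ⁻¹' {a}) L)
    (hout : ((f ⁻¹' {a}) \ L).Nonempty)
    (hint : ∃ v ∈ L, ¬ IsCutVertexOf G (f ⁻¹' {a}) v ∧ ∃ u : V, G.Adj v u ∧ f u ≠ a)
    (hnohit : ¬ HitsLeafCrucial G H L f) :
    ∃ g : V → W, Relation.ReflTransGen (ModelStep G H) f g ∧
      (∀ v ∈ L, ¬ IsCutVertexOf G (f ⁻¹' {a}) v → g v ≠ f v) ∧
      (∀ u : V, ¬ (u ∈ L ∧ ¬ IsCutVertexOf G (f ⁻¹' {a}) u) → g u = f u) := by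
  classical
  have hconn : SetConn G (f ⁻¹' {a}) := (connected_induce_iff_setConn.1 (hf.1 a).2).2
  have hLA : ∀ u ∈ L, f u = a := fun u hu => hL.1.1 hu
  obtain ⟨c, hcL, hc⟩ : ∃ c ∈ L, IsCutVertexOf G (f ⁻¹' {a}) c := by
    by_contra hno
    have hLeq : L = f ⁻¹' {a} := by
      refine hconn L ⟨hL.1.1, fun u hu w hw huw => ?_⟩ hL.1.2.1
      by_contra hwL
      exact hno ⟨u, hu, hL.1.isCutVertexOf_of_adj hu hw hwL huw⟩
    obtain ⟨z, hz, hzL⟩ := hout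
    exact hzL (hLeq ▸ hz)
  have hcut : ∀ v ∈ L, (¬ IsCutVertexOf G (f ⁻¹' {a}) v ↔ v ≠ c) := fun v hv =>
    not_congr ⟨fun h => hL.2 v c hv hcL h hc, fun h => h ▸ hc⟩
  have hLc : ∀ u ∈ L, u ≠ c → ∀ w, f w = a → G.Adj u w → w ∈ L := by
    intro u hu huc w hw huw
    by_contra hwL
    exact (hcut u hu).2 huc (hL.1.isCutVertexOf_of_adj hu hw hwL huw)
  have hint' : ∃ v ∈ L, v ≠ c ∧ ∃ u, G.Adj v u ∧ f u ≠ a := by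
    obtain ⟨v, hv, hvc, hu⟩ := hint
    exact ⟨v, hv, (hcut v hv).1 hvc, hu⟩
  have hnlc : ∀ h, ReachWithin G H L f h → ¬ LeafCrucialModel G H h := by
    intro h hfh hlc
    refine hnohit fun g hg => ⟨h, ?_, hlc⟩
    exact Relation.ReflTransGen.trans hg.symm hfh
  obtain ⟨P, ⟨h, hfh, heq, rfl⟩, hmin⟩ := exists_minimal_of_wellFoundedLT
    (fun P : Set V => ∃ h : V → W, ReachWithin G H L f h ∧
      (∀ u, ¬ (u ∈ L ∧ u ≠ c) → h u = f u) ∧ P = {v | v ∈ L ∧ v ≠ c ∧ h v = a})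
    ⟨_, f, Relation.ReflTransGen.refl, fun _ _ => rfl, rfl⟩
  refine ⟨h, hfh.reflTransGen_modelStep, fun v hv hvc hvf => ?_, fun u hu => heq u fun hu' =>
    hu ⟨hu'.1, (hcut u hu'.1).2 hu'.2⟩⟩
  have hh := hfh.isModel hf
  obtain ⟨z, hzL, hzc, rfl, ⟨B, hB, hzB⟩, hzcut, u, hzu, hu⟩ :=
    exists_interior_leaf_adj hL.1 hcL hLc hint' hh heq
      ⟨v, hv, (hcut v hv).1 hvc, hvf.trans (hLA v hv)⟩
  obtain ⟨b, hb, hmodel⟩ := hh.exists_update hzu hu hzcut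
    ⟨c, (heq c fun h' => h'.2 rfl).trans (hLA c hcL), hzc.symm⟩
    fun hcr => hnlc h hfh ⟨z, B, hB, hzB, hzcut, hcr⟩
  have hle := hmin (y := {v | v ∈ L ∧ v ≠ c ∧ Function.update h z b v = h z})
    ⟨Function.update h z b, hfh.tail ⟨hh, hmodel, z, hzL, by simpa using hb.symm,
        fun y hy => (Function.update_of_ne hy b h).symm⟩,
      fun y hy => (Function.update_of_ne (fun hyz : y = z => hy (hyz ▸ ⟨hzL, hzc⟩)) b h).trans
        (heq y hy), rfl⟩ (by
      rintro y ⟨hyL, hyc, hy⟩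
      refine ⟨hyL, hyc, ?_⟩
      by_cases hyz : y = z
      · rw [hyz]
      · rwa [Function.update_of_ne hyz] at hy)
  have hz := (hle ⟨hzL, hzc, rfl⟩).2.2
  rw [Function.update_self] at hz
  exact hb hz
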